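/- arXiv:1612.06003 — 5 statements merged into one kernel-verified Lean document; each statement's English description precedes it below -/
import Mathlib

section
/- Let h : ℝ^N → ℝ be convex, let g : ℝ^N → ℝ be differentiable (possibly non-convex) with L-Lipschitz continuous gradient, let 0 < γ < 1/L, and let x* be a global minimizer of f = g + h. Let x_0 ∈ ℝ^N and let the IPG iterates satisfy x_k ∈ Prox^{ε_k}_{γh}(x_{k−1} − γ∇g(x_{k−1})) with errors ε_k ≥ 0 for k = 1, …, m. Then (1/m)·Σ_{k=1}^m ‖x_k − x_{k−1}‖² ≤ (1/m)·( 2A_m + √( (f(x_0) − f(x*)) / (1/γ − L/2) ) + √(B_m) )², where A_m = (1/2)·Σ_{k=1}^m (1/(1/γ − L/2))·√(2ε_k/γ) and B_m = (1/(1/γ − L/2))·Σ_{k=1}^m ε_k. -/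
open scoped RealInnerProductSpace
open Filter Topology

noncomputable section

abbrev E (N : ℕ) := EuclideanSpace ℝ (Fin N)

/-- `z` is an `ε`-inexact proximal point of `h` with stepsize `γ` at `y`:
`(1/(2γ))‖z − y‖² + h(z) ≤ ε + (1/(2γ))‖x − y‖² + h(x)` for all `x`. -/
def IsInexactProx {N : ℕ} (γ : ℝ) (h : E N → ℝ) (ε : ℝ) (y z : E N) : Prop :=
  ∀ x : E N, 1 / (2 * γ) * ‖z - y‖ ^ 2 + h z ≤ ε + 1 / (2 * γ) * ‖x - y‖ ^ 2 + h x

/-- The `ε`-approximate subdifferential of `h` at `x`. -/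
def epsSubdiff {N : ℕ} (h : E N → ℝ) (ε : ℝ) (x : E N) : Set (E N) :=
  {d : E N | ∀ y : E N, h y ≥ h x + ⟪d, y - x⟫ - ε}


/-- The descent lemma: a function whose gradient is `L`-Lipschitz is bounded above by its
quadratic model. -/
lemma le_quadratic_of_lipschitz_gradient {F : Type*} [NormedAddCommGroup F]
    [InnerProductSpace ℝ F] [CompleteSpace F] {g : F → ℝ} {g' : F → F} {L : ℝ}
    (hg : ∀ x, HasGradientAt g (g' x) x)
    (hlip : ∀ x y, ‖g' x - g' y‖ ≤ L * ‖x - y‖) (w d : F) :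
    g (w + d) ≤ g w + ⟪g' w, d⟫ + L / 2 * ‖d‖ ^ 2 := by
  have hderiv (t : ℝ) : HasDerivAt (fun t : ℝ => g (w + t • d)) ⟪g' (w + t • d), d⟫ t := by
    have hline : HasDerivAt (fun t : ℝ => w + t • d) d t := by
      simpa using ((hasDerivAt_id t).smul_const d).const_add w
    exact ((hg (w + t • d)).hasFDerivAt.comp_hasDerivAt t hline).congr_deriv (by simp)
  have hmodel (t : ℝ) : HasDerivAt
      (fun t : ℝ => g w + t * ⟪g' w, d⟫ + L / 2 * ‖d‖ ^ 2 * t ^ 2)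
      (⟪g' w, d⟫ + L * ‖d‖ ^ 2 * t) t := by
    have h₁ := ((hasDerivAt_id t).mul_const ⟪g' w, d⟫).const_add (g w)
    have h₂ := (hasDerivAt_pow 2 t).const_mul (L / 2 * ‖d‖ ^ 2)
    exact (h₁.add h₂).congr_deriv (by push_cast; ring)
  have key := image_le_of_deriv_right_le_deriv_boundary (a := 0) (b := 1)
    (fun t _ => (hderiv t).continuousAt.continuousWithinAt)
    (fun t _ => (hderiv t).hasDerivWithinAt) (by simp)
    (fun t _ => (hmodel t).continuousAt.continuousWithinAt)
    (fun t _ => (hmodel t).hasDerivWithinAt) (fun t ht => ?_)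
    (Set.right_mem_Icc.2 zero_le_one)
  · simpa using key
  · have hcs := real_inner_le_norm (g' (w + t • d) - g' w) d
    have hl := hlip (w + t • d) w
    rw [add_sub_cancel_left, norm_smul, Real.norm_of_nonneg ht.1] at hl
    rw [inner_sub_left] at hcs
    nlinarith [mul_le_mul_of_nonneg_right hl (norm_nonneg d)]

/-- If `t * X ≤ ε + t² * c` for all `t ∈ (0, 1]`, then optimizing over `t` bounds `X`. -/
lemma le_add_two_mul_sqrt_of_forall_mul_le {X ε r : ℝ} (hε : 0 ≤ ε) (hr : 0 ≤ r)
    (H : ∀ t : ℝ, 0 < t → t ≤ 1 → t * X ≤ ε + t ^ 2 * r ^ 2) :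
    X ≤ ε + 2 * Real.sqrt ε * r := by
  obtain ⟨s, hs, rfl⟩ : ∃ s : ℝ, 0 ≤ s ∧ ε = s ^ 2 :=
    ⟨√ε, Real.sqrt_nonneg _, (Real.sq_sqrt hε).symm⟩
  rw [Real.sqrt_sq hs]
  rcases hs.eq_or_lt with rfl | hs
  · by_contra! hX
    have hX : 0 < X := by simpa using hX
    have hp : 0 < X + r ^ 2 := by positivity
    have h₁ := H (X / (X + r ^ 2) / 2) (by positivity) (by
      rw [div_div, div_le_one (by positivity)]; nlinarith [sq_nonneg r])
    set t := X / (X + r ^ 2) / 2 with ht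
    have ht0 : 0 < t := by positivity
    have h₂ : X ≤ t * r ^ 2 := by
      refine le_of_mul_le_mul_left ?_ ht0
      linarith
    have h₃ : 2 * t * (X + r ^ 2) = X := by rw [ht]; field_simp
    nlinarith
  · rcases le_or_gt r s with hrs | hrs
    · nlinarith [H 1 one_pos le_rfl]
    · have hr0 : 0 < r := hs.trans hrs
      have h₁ := H (s / r) (by positivity) ((div_le_one hr0).2 hrs.le)
      have h₂ : s * X ≤ s * (2 * s * r) := by
        have h₃ : s * X / r ≤ 2 * s ^ 2 := by
          calc s * X / r = s / r * X := by ring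
            _ ≤ s ^ 2 + (s / r) ^ 2 * r ^ 2 := h₁
            _ = 2 * s ^ 2 := by field_simp; ring
        rw [div_le_iff₀ hr0] at h₃
        linarith
      nlinarith [le_of_mul_le_mul_left h₂ hs]

/-- An inexact proximal step of a convex function, taken from `w - γ • v`, decreases `h` up to
the linear term `⟪v, z - w⟫` and error terms. -/
lemma IsInexactProx.le_of_convexOn {N : ℕ} {γ ε : ℝ} {h : E N → ℝ} {w v z : E N}
    (hz : IsInexactProx γ h ε (w - γ • v) z) (hconv : ConvexOn ℝ Set.univ h)
    (hγ : 0 < γ) (hε : 0 ≤ ε) :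
    h z + 1 / γ * ‖z - w‖ ^ 2 + ⟪v, z - w⟫ ≤
      h w + ε + Real.sqrt (2 * ε / γ) * ‖z - w‖ := by
  have hsqrt : Real.sqrt (2 * ε / γ) * ‖z - w‖ =
      2 * Real.sqrt ε * (‖z - w‖ / Real.sqrt (2 * γ)) := by
    have h4 : 2 * ε / γ = 2 ^ 2 * ε / (2 * γ) := by field_simp
    rw [h4, Real.sqrt_div (by positivity), Real.sqrt_mul (by positivity),
      Real.sqrt_sq (by norm_num)]
    ring
  have hopt := le_add_two_mul_sqrt_of_forall_mul_le
    (X := h z + 1 / γ * ‖z - w‖ ^ 2 + ⟪v, z - w⟫ - h w) (r := ‖z - w‖ / √(2 * γ)) hε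
    (by positivity) (fun t ht0 ht1 => ?_)
  · linarith
  have hc := hconv.2 (Set.mem_univ z) (Set.mem_univ w) (sub_nonneg.2 ht1) ht0.le (by ring)
  have hp := hz ((1 - t) • z + t • w)
  obtain ⟨d, rfl⟩ : ∃ d, z = w + d := ⟨z - w, by abel⟩
  have e₁ : w + d - (w - γ • v) = d + γ • v := by abel
  have e₂ : (1 - t) • (w + d) + t • w - (w - γ • v) = (1 - t) • d + γ • v := by module
  rw [e₁, e₂, norm_add_sq_real, norm_add_sq_real] at hp
  simp only [norm_smul, inner_smul_left, inner_smul_right, mul_pow, Real.norm_eq_abs, sq_abs,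
    conj_trivial, smul_eq_mul] at hp hc
  rw [add_sub_cancel_left, div_pow, Real.sq_sqrt (by positivity), real_inner_comm]
  have e₃ : 1 / (2 * γ) * (‖d‖ ^ 2 + 2 * (γ * ⟪d, v⟫) + γ ^ 2 * ‖v‖ ^ 2) -
      1 / (2 * γ) * ((1 - t) ^ 2 * ‖d‖ ^ 2 + 2 * (γ * ((1 - t) * ⟪d, v⟫)) + γ ^ 2 * ‖v‖ ^ 2) =
      t * (1 / γ * ‖d‖ ^ 2 + ⟪d, v⟫) - t ^ 2 * (‖d‖ ^ 2 / (2 * γ)) := by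
    field_simp
    ring
  linarith

/-- Telescoping over `Finset.Icc 1 m`. -/
lemma sum_Icc_one_sub (F : ℕ → ℝ) (m : ℕ) :
    ∑ k ∈ Finset.Icc 1 m, (F (k - 1) - F k) = F 0 - F m := by
  induction m with
  | zero => simp
  | succ n ih => rw [Finset.sum_Icc_succ_top (by omega), ih]; simp

/-- convergence rate of IPG when `h` is convex. -/
theorem ipg_rate_convex_h {N : ℕ} (g h : E N → ℝ) (g' : E N → E N) (L γ : ℝ)
    (hL : 0 < L)
    (hg : ∀ x, HasGradientAt g (g' x) x)
    (hlip : ∀ x y, ‖g' x - g' y‖ ≤ L * ‖x - y‖)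
    (hconv : ConvexOn ℝ Set.univ h)
    (hγ0 : 0 < γ) (hγL : γ < 1 / L)
    (xstar : E N) (hmin : ∀ y, g xstar + h xstar ≤ g y + h y)
    (m : ℕ) (hm : 1 ≤ m) (x : ℕ → E N) (ε : ℕ → ℝ)
    (hε : ∀ k ∈ Finset.Icc 1 m, 0 ≤ ε k)
    (hstep : ∀ k ∈ Finset.Icc 1 m,
      IsInexactProx γ h (ε k) (x (k - 1) - γ • g' (x (k - 1))) (x k)) :
    (1 / (m : ℝ)) * ∑ k ∈ Finset.Icc 1 m, ‖x k - x (k - 1)‖ ^ 2 ≤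
      (1 / (m : ℝ)) *
        (2 * ((1 / 2) * ∑ k ∈ Finset.Icc 1 m,
              1 / (1 / γ - L / 2) * Real.sqrt (2 * ε k / γ)) +
          Real.sqrt ((g (x 0) + h (x 0) - (g xstar + h xstar)) / (1 / γ - L / 2)) +
          Real.sqrt (1 / (1 / γ - L / 2) * ∑ k ∈ Finset.Icc 1 m, ε k)) ^ 2 := by
  set α := 1 / γ - L / 2 with hα
  have hα0 : 0 < α := by
    have h1 : L < 1 / γ := by rwa [lt_div_iff₀ hγ0, mul_comm, ← lt_div_iff₀ hL]
    rw [hα]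
    linarith
  set f : ℕ → ℝ := fun k => g (x k) + h (x k) with hf
  set D : ℕ → ℝ := fun k => ‖x k - x (k - 1)‖ with hD
  have hdecr : ∀ k ∈ Finset.Icc 1 m,
      α * D k ^ 2 ≤ (f (k - 1) - f k) + ε k + √(2 * ε k / γ) * D k := by
    intro k hk
    have h₁ := (hstep k hk).le_of_convexOn hconv hγ0 (hε k hk)
    have h₂ := le_quadratic_of_lipschitz_gradient hg hlip (x (k - 1)) (x k - x (k - 1))
    rw [add_sub_cancel] at h₂
    simp only [hα, hf, hD]
    linarith
  set S := √(∑ k ∈ Finset.Icc 1 m, D k ^ 2)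
  have hS0 : 0 ≤ S := Real.sqrt_nonneg _
  have hS2 : S ^ 2 = ∑ k ∈ Finset.Icc 1 m, D k ^ 2 :=
    Real.sq_sqrt (Finset.sum_nonneg fun k _ => sq_nonneg _)
  have hDS : ∀ k ∈ Finset.Icc 1 m, D k ≤ S := fun k hk =>
    Real.le_sqrt_of_sq_le
      (Finset.single_le_sum (f := fun k => D k ^ 2) (fun _ _ => sq_nonneg _) hk)
  have hsum : α * S ^ 2 ≤ (f 0 - f m) + ∑ k ∈ Finset.Icc 1 m, ε k +
      (∑ k ∈ Finset.Icc 1 m, √(2 * ε k / γ)) * S := by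
    rw [hS2, Finset.mul_sum, Finset.sum_mul, ← sum_Icc_one_sub f m, ← Finset.sum_add_distrib,
      ← Finset.sum_add_distrib]
    refine Finset.sum_le_sum fun k hk => (hdecr k hk).trans ?_
    gcongr
    exact hDS k hk
  set T := ∑ k ∈ Finset.Icc 1 m, ε k
  have hε0 : 0 ≤ T := Finset.sum_nonneg hε
  set R := ∑ k ∈ Finset.Icc 1 m, √(2 * ε k / γ)
  have hR0 : 0 ≤ R := Finset.sum_nonneg fun k _ => Real.sqrt_nonneg _
  set Δ := g (x 0) + h (x 0) - (g xstar + h xstar)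
  have hΔ0 : 0 ≤ Δ := sub_nonneg.2 (hmin _)
  have hΔm : f 0 - f m ≤ Δ := sub_le_sub_left (hmin (x m)) _
  have hquad : S ^ 2 ≤ Δ / α + 1 / α * T + 1 / α * R * S := by
    have h₁ : S ^ 2 ≤ (Δ + T + R * S) / α := by
      rw [le_div_iff₀ hα0]
      linarith
    exact h₁.trans_eq (by ring)
  rw [← Finset.mul_sum, ← hS2]
  have hp2 := Real.sq_sqrt (show 0 ≤ Δ / α by positivity)
  have hq2 := Real.sq_sqrt (show 0 ≤ 1 / α * T by positivity)
  have hp0 := Real.sqrt_nonneg (Δ / α)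
  have hq0 := Real.sqrt_nonneg (1 / α * T)
  have hA0 : 0 ≤ 1 / α * R := by positivity
  gcongr
  by_contra! hlt
  nlinarith [mul_nonneg hp0 hq0, mul_nonneg hA0 hS0]
end
end

section
/- (Convergence of AIPG to a critical point.) Let h : ℝ^N → ℝ be convex, let g : ℝ^N → ℝ be differentiable (possibly non-convex) with L-Lipschitz continuous gradient, let 0 < γ < 1/L, and suppose f = g + h is bounded below. Let (x_k) and (v_k) be sequences in ℝ^N such that for every k, v_{k+1} ∈ Prox^{ε_k}_{γh}(x_k − γ∇g(x_k)) and f(x_{k+1}) ≤ f(v_{k+1}), where the errors ε_k ≥ 0 form a nonincreasing sequence with Σ_{k=1}^∞ ε_k < ∞. Then Σ_{k=1}^∞ ‖v_{k+1} − x_k‖² < ∞ (so ‖v_{k+1} − x_k‖ → 0), and there exist vectors d_k ∈ ∂_{ε_k} h(v_{k+1}) such that ‖∇g(v_{k+1}) + d_k‖ → 0 as k → ∞. -/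
open scoped RealInnerProductSpace
open Filter Topology

noncomputable section

section

variable {F : Type*} [NormedAddCommGroup F] [InnerProductSpace ℝ F]

/-- The descent lemma for functions with Lipschitz continuous gradient. -/
theorem le_add_inner_add_of_lipschitz_gradient [CompleteSpace F] {g : F → ℝ} {g' : F → F} {L : ℝ}
    (hg : ∀ x, HasGradientAt g (g' x) x) (hlip : ∀ x y, ‖g' x - g' y‖ ≤ L * ‖x - y‖) (x z : F) :
    g z ≤ g x + ⟪g' x, z - x⟫ + L / 2 * ‖z - x‖ ^ 2 := by
  have hder (t : ℝ) : HasDerivAt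
      (fun t : ℝ => g (x + t • (z - x)) - t * ⟪g' x, z - x⟫ - t ^ 2 * (L / 2 * ‖z - x‖ ^ 2))
      (⟪g' (x + t • (z - x)), z - x⟫ - 1 * ⟪g' x, z - x⟫ -
        (2 * t) * (L / 2 * ‖z - x‖ ^ 2)) t := by
    have hline : HasDerivAt (fun t : ℝ => x + t • (z - x)) (z - x) t := by
      simpa using ((hasDerivAt_id t).smul_const (z - x)).const_add x
    have hcomp := (hg (x + t • (z - x))).hasFDerivAt.comp_hasDerivAt t hline
    have hsq : HasDerivAt (fun t : ℝ => t ^ 2) (2 * t) t := by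
      simpa using hasDerivAt_pow 2 t
    exact (hcomp.sub ((hasDerivAt_id t).mul_const _)).sub (hsq.mul_const _)
  have hanti := antitoneOn_of_deriv_nonpos (convex_Icc (0 : ℝ) 1)
    (fun t _ => (hder t).continuousAt.continuousWithinAt)
    (fun t _ => (hder t).differentiableAt.differentiableWithinAt)
    (fun t ht => by
      rw [interior_Icc] at ht
      rw [(hder t).deriv, one_mul, ← inner_sub_left]
      have hnorm : ‖g' (x + t • (z - x)) - g' x‖ ≤ L * (t * ‖z - x‖) := by
        simpa [norm_smul, abs_of_pos ht.1] using hlip (x + t • (z - x)) x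
      have hinner := (real_inner_le_norm (g' (x + t • (z - x)) - g' x) (z - x)).trans
        (mul_le_mul_of_nonneg_right hnorm (norm_nonneg _))
      linarith)
  have h01 := hanti (Set.left_mem_Icc.2 zero_le_one) (Set.right_mem_Icc.2 zero_le_one) zero_le_one
  simp only [one_smul, zero_smul, add_sub_cancel, add_zero] at h01
  linarith

/-- The optimality condition for a minimizer of `c * ‖· - y‖ ^ 2 + h` with `h` convex. -/
theorem add_inner_le_of_forall_prox_le {h : F → ℝ} (hconv : ConvexOn ℝ Set.univ h) {c : ℝ}
    {y p : F} (hp : ∀ u, c * ‖p - y‖ ^ 2 + h p ≤ c * ‖u - y‖ ^ 2 + h u) (u : F) :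
    h p + 2 * c * ⟪y - p, u - p⟫ ≤ h u := by
  have key : ∀ t ∈ Set.Ioo (0 : ℝ) 1,
      h p + 2 * c * ⟪y - p, u - p⟫ ≤ h u + t * (c * ‖u - p‖ ^ 2) := by
    intro t ht
    have hmin := hp ((1 - t) • p + t • u)
    have hcv := hconv.2 (Set.mem_univ p) (Set.mem_univ u) (sub_nonneg.2 ht.2.le) ht.1.le
      (sub_add_cancel 1 t)
    have hsq : ‖(1 - t) • p + t • u - y‖ ^ 2 =
        ‖p - y‖ ^ 2 - 2 * t * ⟪y - p, u - p⟫ + t ^ 2 * ‖u - p‖ ^ 2 := by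
      rw [show (1 - t) • p + t • u - y = (p - y) + t • (u - p) by module, norm_add_sq_real,
        norm_smul, mul_pow, inner_smul_right, ← neg_sub y p, inner_neg_left, norm_neg,
        Real.norm_eq_abs, sq_abs]
      ring
    rw [hsq] at hmin
    simp only [smul_eq_mul] at hcv
    refine le_of_mul_le_mul_left ?_ ht.1
    linarith
  have hlim : Tendsto (fun t : ℝ => h u + t * (c * ‖u - p‖ ^ 2)) (𝓝[>] 0) (𝓝 (h u)) := by
    have hcont : Continuous fun t : ℝ => h u + t * (c * ‖u - p‖ ^ 2) := by fun_prop
    simpa using (hcont.tendsto 0).mono_left nhdsWithin_le_nhds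
  exact ge_of_tendsto hlim (eventually_of_mem (Ioo_mem_nhdsGT zero_lt_one) key)

/-- In finite dimension, a convex function for which an approximate proximal point exists
has an exact proximal point. -/
theorem exists_forall_prox_le [FiniteDimensional ℝ F] {h : F → ℝ}
    (hconv : ConvexOn ℝ Set.univ h) {c ε : ℝ} (hc : 0 < c) {y z : F}
    (hz : ∀ u, c * ‖z - y‖ ^ 2 + h z ≤ ε + c * ‖u - y‖ ^ 2 + h u) :
    ∃ p, ∀ u, c * ‖p - y‖ ^ 2 + h p ≤ c * ‖u - y‖ ^ 2 + h u := by
  have hcont : Continuous fun u => c * ‖u - y‖ ^ 2 + h u := by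
    have : Continuous h := continuousOn_univ.1 (hconv.continuousOn isOpen_univ)
    fun_prop
  have hε : 0 ≤ ε := by linarith [hz z]
  have hsublevel (u : F) (hu : c * ‖u - y‖ ^ 2 + h u ≤ c * ‖z - y‖ ^ 2 + h z) :
      u ∈ Metric.closedBall z √(4 * ε / c) := by
    have hmid := hz ((1 / 2 : ℝ) • z + (1 / 2 : ℝ) • u)
    have hcv := hconv.2 (Set.mem_univ z) (Set.mem_univ u) (by norm_num : (0 : ℝ) ≤ 1 / 2)
      (by norm_num : (0 : ℝ) ≤ 1 / 2) (by norm_num)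
    have hsq : ‖(1 / 2 : ℝ) • z + (1 / 2 : ℝ) • u - y‖ ^ 2 =
        (‖z - y‖ ^ 2 + ‖u - y‖ ^ 2) / 2 - ‖u - z‖ ^ 2 / 4 := by
      rw [show (1 / 2 : ℝ) • z + (1 / 2 : ℝ) • u - y = (1 / 2 : ℝ) • ((u - y) + (z - y)) by module,
        show u - z = (u - y) - (z - y) by abel, norm_smul, mul_pow, norm_add_sq_real,
        norm_sub_sq_real (u - y)]
      norm_num
      ring
    rw [hsq] at hmid
    simp only [smul_eq_mul] at hcv
    rw [mem_closedBall_iff_norm]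
    apply Real.le_sqrt_of_sq_le
    rw [le_div_iff₀ hc]
    linarith
  obtain ⟨p, -, hp⟩ := (isCompact_closedBall z √(4 * ε / c)).exists_isMinOn
    ⟨z, Metric.mem_closedBall_self (Real.sqrt_nonneg _)⟩ hcont.continuousOn
  refine ⟨p, fun u => ?_⟩
  by_cases hu : u ∈ Metric.closedBall z √(4 * ε / c)
  · exact hp hu
  · have hzu := mt (hsublevel u) hu
    have hpz := hp (Metric.mem_closedBall_self (x := z) (Real.sqrt_nonneg (4 * ε / c)))
    simp only [Set.mem_ofPred_eq] at hpz
    linarith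

end

/-- An inexact proximal point of a convex function is close to an exact one, whose residual is an
approximate subgradient at the inexact point. -/
theorem IsInexactProx.exists_mem_epsSubdiff {N : ℕ} {γ : ℝ} {h : E N → ℝ} {ε : ℝ} {y z : E N}
    (hγ : 0 < γ) (hconv : ConvexOn ℝ Set.univ h) (hz : IsInexactProx γ h ε y z) :
    ∃ p : E N, (1 / γ) • (y - p) ∈ epsSubdiff h ε z ∧ ‖z - p‖ ^ 2 ≤ 2 * γ * ε := by
  have hc : 0 < 1 / (2 * γ) := by positivity
  obtain ⟨p, hp⟩ := exists_forall_prox_le hconv hc hz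
  have hsub := add_inner_le_of_forall_prox_le hconv hp
  have hzp := hz p
  have hsq : ‖z - y‖ ^ 2 = ‖z - p‖ ^ 2 - 2 * ⟪y - p, z - p⟫ + ‖p - y‖ ^ 2 := by
    rw [show z - y = (z - p) - (y - p) by abel, norm_sub_sq_real, real_inner_comm,
      norm_sub_rev p y]
  have hcγ : 1 / γ = 2 * (1 / (2 * γ)) := by field_simp
  rw [hsq] at hzp
  refine ⟨p, fun u => ?_, ?_⟩
  · have hsplit : ⟪y - p, u - z⟫ = ⟪y - p, u - p⟫ - ⟪y - p, z - p⟫ := by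
      rw [← inner_sub_right, sub_sub_sub_cancel_right]
    rw [real_inner_smul_left, hcγ, hsplit]
    have := mul_nonneg hc.le (sq_nonneg ‖z - p‖)
    linarith [hsub u]
  · have hle : 1 / (2 * γ) * ‖z - p‖ ^ 2 ≤ ε := by linarith [hsub z]
    rwa [one_div, inv_mul_le_iff₀ (by positivity)] at hle

/-- Sufficient decrease of an inexact proximal gradient step. -/
theorem IsInexactProx.sufficient_decrease {N : ℕ} {g h : E N → ℝ} {g' : E N → E N} {L γ ε : ℝ}
    (hg : ∀ x, HasGradientAt g (g' x) x) (hlip : ∀ x y, ‖g' x - g' y‖ ≤ L * ‖x - y‖)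
    (hγ : 0 < γ) {x z : E N} (hz : IsInexactProx γ h ε (x - γ • g' x) z) :
    g z + h z + (1 / (2 * γ) - L / 2) * ‖z - x‖ ^ 2 ≤ g x + h x + ε := by
  have hdescent := le_add_inner_add_of_lipschitz_gradient hg hlip x z
  have hx := hz x
  rw [show z - (x - γ • g' x) = (z - x) + γ • g' x by abel, sub_sub_cancel, norm_add_sq_real,
    inner_smul_right, real_inner_comm] at hx
  have hcancel : 1 / (2 * γ) * (2 * (γ * ⟪g' x, z - x⟫)) = ⟪g' x, z - x⟫ := by field_simp
  linarith

/-- If a sequence bounded below decreases by `a k` up to a summable error, then `a` is summable. -/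
theorem summable_of_add_le_add_of_summable {F a ε : ℕ → ℝ} (hF : BddBelow (Set.range F))
    (ha : ∀ k, 0 ≤ a k) (hε : ∀ k, 0 ≤ ε k) (hεsum : Summable ε)
    (hstep : ∀ k, F (k + 1) + a k ≤ F k + ε k) : Summable a := by
  obtain ⟨m, hm⟩ := hF
  refine summable_of_sum_range_le (c := F 0 - m + ∑' k, ε k) ha fun n => ?_
  have hsum : F n + ∑ k ∈ Finset.range n, a k ≤ F 0 + ∑ k ∈ Finset.range n, ε k := by
    induction n with
    | zero => simp
    | succ n ih =>
      rw [Finset.sum_range_succ, Finset.sum_range_succ]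
      linarith [hstep n]
  have := hεsum.sum_le_tsum (Finset.range n) fun k _ => hε k
  linarith [hm (Set.mem_range_self n)]

/-- convergence of AIPG to a critical point. -/
theorem aipg_converges_to_critical_point {N : ℕ} (g h : E N → ℝ) (g' : E N → E N)
    (L γ : ℝ) (hL : 0 < L)
    (hg : ∀ x, HasGradientAt g (g' x) x)
    (hlip : ∀ x y, ‖g' x - g' y‖ ≤ L * ‖x - y‖)
    (hconv : ConvexOn ℝ Set.univ h)
    (hγ0 : 0 < γ) (hγL : γ < 1 / L)
    (hbdd : BddBelow (Set.range fun y => g y + h y))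
    (x v : ℕ → E N) (ε : ℕ → ℝ)
    (hε : ∀ k, 0 ≤ ε k) (hεmono : ∀ k, ε (k + 1) ≤ ε k) (hεsum : Summable ε)
    (hstep : ∀ k, IsInexactProx γ h (ε k) (x k - γ • g' (x k)) (v (k + 1)))
    (hdesc : ∀ k, g (x (k + 1)) + h (x (k + 1)) ≤ g (v (k + 1)) + h (v (k + 1))) :
    Summable (fun k => ‖v (k + 1) - x k‖ ^ 2) ∧
      Tendsto (fun k => ‖v (k + 1) - x k‖) atTop (𝓝 0) ∧
      ∃ d : ℕ → E N, (∀ k, d k ∈ epsSubdiff h (ε k) (v (k + 1))) ∧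
        Tendsto (fun k => ‖g' (v (k + 1)) + d k‖) atTop (𝓝 0) := by
  have hc : 0 < 1 / (2 * γ) - L / 2 := by
    rw [lt_div_iff₀ hL] at hγL
    rw [sub_pos, div_lt_div_iff₀ two_pos (by positivity)]
    linarith
  have hsum : Summable fun k => ‖v (k + 1) - x k‖ ^ 2 := by
    rw [← summable_mul_left_iff hc.ne']
    refine summable_of_add_le_add_of_summable (F := fun k => g (x k) + h (x k))
      (hbdd.mono (Set.range_comp_subset_range x fun y => g y + h y)) (fun k => by positivity)
      hε hεsum fun k => ?_
    linarith [(hstep k).sufficient_decrease hg hlip hγ0, hdesc k]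
  have htend : Tendsto (fun k => ‖v (k + 1) - x k‖) atTop (𝓝 0) := by
    simpa using hsum.tendsto_atTop_zero.sqrt
  refine ⟨hsum, htend, ?_⟩
  choose p hp hvp using fun k => (hstep k).exists_mem_epsSubdiff hγ0 hconv
  refine ⟨_, hp, ?_⟩
  have hlim : Tendsto (fun k => (L + 1 / γ) * ‖v (k + 1) - x k‖ + 1 / γ * √(2 * γ * ε k))
      atTop (𝓝 0) := by
    simpa using (htend.const_mul (L + 1 / γ)).add
      ((hεsum.tendsto_atTop_zero.const_mul (2 * γ)).sqrt.const_mul (1 / γ))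
  refine squeeze_zero (fun k => norm_nonneg _) (fun k => ?_) hlim
  have hsplit : g' (v (k + 1)) + (1 / γ) • (x k - γ • g' (x k) - p k) =
      (g' (v (k + 1)) - g' (x k)) - (1 / γ) • (v (k + 1) - x k) +
        (1 / γ) • (v (k + 1) - p k) := by
    have hcancel : (1 / γ) • γ • g' (x k) = g' (x k) := by
      rw [smul_smul, one_div_mul_cancel hγ0.ne', one_smul]
    simp only [smul_sub, hcancel]
    abel
  have hnorm (w : E N) : ‖(1 / γ) • w‖ = 1 / γ * ‖w‖ := by
    rw [norm_smul, Real.norm_of_nonneg (by positivity)]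
  calc ‖g' (v (k + 1)) + (1 / γ) • (x k - γ • g' (x k) - p k)‖
      ≤ ‖g' (v (k + 1)) - g' (x k)‖ + ‖(1 / γ) • (v (k + 1) - x k)‖ +
          ‖(1 / γ) • (v (k + 1) - p k)‖ := by
        rw [hsplit]
        exact (norm_add_le _ _).trans (by gcongr; exact norm_sub_le _ _)
    _ ≤ L * ‖v (k + 1) - x k‖ + 1 / γ * ‖v (k + 1) - x k‖ + 1 / γ * √(2 * γ * ε k) := by
        rw [hnorm, hnorm]
        gcongr
        · exact hlip _ _
        · exact Real.le_sqrt_of_sq_le (hvp k)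
    _ = (L + 1 / γ) * ‖v (k + 1) - x k‖ + 1 / γ * √(2 * γ * ε k) := by ring
end
end

section
/- (Theorem 5: O(1/T²) rate of AIPG for convex problems.) Let g : ℝ^N → ℝ be convex and differentiable with L-Lipschitz continuous gradient, let h : ℝ^N → ℝ be convex, let f = g + h, let x* be a global minimizer of f, and let 0 < γ ≤ 1/L. Define t_0 = 0, t_1 = 1 and t_{k+1} = (√(4t_k² + 1) + 1)/2. Let x_0 ∈ ℝ^N, x_1 = z_1 = x_0, and for k = 1, …, m let: y_k = x_k + (t_{k−1}/t_k)(z_k − x_k) + ((t_{k−1} − 1)/t_k)(x_k − x_{k−1}); z_{k+1} ∈ Prox^{ε_k}_{γh}(y_k − γ∇g(y_k)); v_{k+1} ∈ Prox^{ε_k}_{γh}(x_k − γ∇g(x_k)); and x_{k+1} = z_{k+1} if f(z_{k+1}) ≤ f(v_{k+1}) and x_{k+1} = v_{k+1} otherwise, with errors ε_k ≥ 0. Then f(x_{m+1}) − f(x*) ≤ ( 2 / ( γ·(m+1)² ) )·( ‖x_0 − x*‖ + 2A_m + √(B_m) )², where A_m = Σ_{k=1}^m t_k·√(2γ·ε_k)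 and B_m = 2γ·Σ_{k=1}^m t_k²·ε_k. (When γ = 1/L this is the bound (2L/(m+1)²)·(‖x_0 − x*‖ + 2A_m + √(B_m))².) -/
open scoped RealInnerProductSpace
open Filter Topology

noncomputable section

section Gradient

variable {F : Type*} [NormedAddCommGroup F] [InnerProductSpace ℝ F] [CompleteSpace F]
  {g : F → ℝ}

theorem HasGradientAt.hasDerivAt_line {a d : F} {s : ℝ} {u : F}
    (hg : HasGradientAt g u (a + s • d)) :
    HasDerivAt (fun s : ℝ => g (a + s • d)) ⟪u, d⟫ s := by
  have hline : HasDerivAt (fun s : ℝ => a + s • d) d s := by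
    simpa using ((hasDerivAt_id s).smul_const d).const_add a
  simpa [Function.comp_def] using hg.hasFDerivAt.comp_hasDerivAt s hline

/-- A convex function lies above its tangent hyperplanes. -/
theorem ConvexOn.add_inner_gradient_le (hconv : ConvexOn ℝ Set.univ g) {a u : F}
    (hg : HasGradientAt g u a) (w : F) : g a + ⟪u, w - a⟫ ≤ g w := by
  have hline : ConvexOn ℝ Set.univ (fun s : ℝ => g (a + s • (w - a))) := by
    refine ⟨convex_univ, fun s _ r _ α β hα hβ hαβ => ?_⟩
    have hcomb : a + (α • s + β • r) • (w - a)
        = α • (a + s • (w - a)) + β • (a + r • (w - a)) := by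
      obtain rfl : β = 1 - α := by linarith
      simp only [smul_eq_mul]
      module
    simp only [hcomb]
    exact hconv.2 (Set.mem_univ _) (Set.mem_univ _) hα hβ hαβ
  have hderiv : HasDerivAt (fun s : ℝ => g (a + s • (w - a))) ⟪u, w - a⟫ 0 :=
    HasGradientAt.hasDerivAt_line (by simpa using hg)
  have hslope := hline.le_slope_of_hasDerivAt (Set.mem_univ 0) (Set.mem_univ 1) one_pos hderiv
  simp [slope_def_field] at hslope
  linarith

/-- The descent lemma for functions with Lipschitz gradient. -/
theorem le_add_inner_gradient_add_sq {g' : F → F} {L : ℝ} (hg : ∀ a, HasGradientAt g (g' a) a)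
    (hlip : ∀ a b, ‖g' a - g' b‖ ≤ L * ‖a - b‖) (a w : F) :
    g w ≤ g a + ⟪g' a, w - a⟫ + L / 2 * ‖w - a‖ ^ 2 := by
  set d := w - a with hd
  have hderiv : ∀ s : ℝ, HasDerivAt
      (fun s : ℝ => g (a + s • d) - s * ⟪g' a, d⟫ - s ^ 2 * (L / 2 * ‖d‖ ^ 2))
      (⟪g' (a + s • d), d⟫ - ⟪g' a, d⟫ - 2 * s * (L / 2 * ‖d‖ ^ 2)) s := by
    intro s
    have hlin : HasDerivAt (fun s : ℝ => s * ⟪g' a, d⟫) ⟪g' a, d⟫ s := by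
      simpa using (hasDerivAt_id s).mul_const ⟪g' a, d⟫
    have hquad : HasDerivAt (fun s : ℝ => s ^ 2 * (L / 2 * ‖d‖ ^ 2))
        (2 * s * (L / 2 * ‖d‖ ^ 2)) s := by
      simpa using (hasDerivAt_pow 2 s).mul_const (L / 2 * ‖d‖ ^ 2)
    exact ((hg (a + s • d)).hasDerivAt_line.sub hlin).sub hquad
  have hanti := antitoneOn_of_deriv_nonpos (convex_Icc (0 : ℝ) 1)
    (fun s _ => (hderiv s).continuousAt.continuousWithinAt)
    (fun s _ => (hderiv s).differentiableAt.differentiableWithinAt)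
    (fun s hs => by
      rw [interior_Icc] at hs
      rw [(hderiv s).deriv, ← inner_sub_left]
      have hcs := real_inner_le_norm (g' (a + s • d) - g' a) d
      have hl := hlip (a + s • d) a
      rw [add_sub_cancel_left, norm_smul, Real.norm_of_nonneg hs.1.le] at hl
      nlinarith [mul_le_mul_of_nonneg_right hl (norm_nonneg d)])
  have h01 := hanti (Set.left_mem_Icc.2 zero_le_one) (Set.right_mem_Icc.2 zero_le_one) zero_le_one
  have hw : a + d = w := by simp [hd]
  simp [hw] at h01
  linarith

end Gradient

section InexactProx

variable {N : ℕ} {γ ε : ℝ} {h : E N → ℝ} {p z : E N}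

theorem IsInexactProx.two_mul_sub_le_of_pos (hγ : 0 < γ) (hε : 0 < ε)
    (hconv : ConvexOn ℝ Set.univ h) (hz : IsInexactProx γ h ε p z) (w : E N) :
    2 * γ * (h z - h w) ≤
      2 * ⟪z - p, w - z⟫ + 2 * γ * ε + 2 * √(2 * γ * ε) * ‖w - z‖ := by
  have hsegment : ∀ s : ℝ, 0 ≤ s → s ≤ 1 →
      s * (2 * γ * (h z - h w)) ≤
        2 * γ * ε + 2 * s * ⟪z - p, w - z⟫ + s ^ 2 * ‖w - z‖ ^ 2 := by
    intro s hs0 hs1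
    have hprox := hz ((1 - s) • z + s • w)
    have hcv := hconv.2 (Set.mem_univ z) (Set.mem_univ w) (sub_nonneg.2 hs1) hs0 (by ring)
    have hpt : (1 - s) • z + s • w - p = (z - p) + s • (w - z) := by module
    rw [hpt, norm_add_sq_real, real_inner_smul_right, norm_smul, mul_pow, Real.norm_eq_abs,
      sq_abs] at hprox
    simp only [smul_eq_mul] at hcv
    have hmul := mul_le_mul_of_nonneg_left (hprox.trans (add_le_add_right hcv _))
      (mul_pos two_pos hγ).le
    field_simp at hmul
    linarith
  have hr : 0 < √(2 * γ * ε) := Real.sqrt_pos.2 (by positivity)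
  have hr2 : √(2 * γ * ε) ^ 2 = 2 * γ * ε := Real.sq_sqrt (by positivity)
  set r := √(2 * γ * ε)
  rcases le_or_gt ‖w - z‖ r with hD | hD
  · have hone := hsegment 1 zero_le_one le_rfl
    nlinarith [norm_nonneg (w - z)]
  · have hD0 : 0 < ‖w - z‖ := hr.trans hD
    have hs := hsegment (r / ‖w - z‖) (by positivity) ((div_le_one hD0).2 hD.le)
    have hsD : r / ‖w - z‖ * ‖w - z‖ = r := div_mul_cancel₀ _ hD0.ne'
    have hs0 : 0 < r / ‖w - z‖ := by positivity
    set s := r / ‖w - z‖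
    refine le_of_mul_le_mul_left (hs.trans ?_) hs0
    have hsr : s ^ 2 * ‖w - z‖ ^ 2 = s * r * ‖w - z‖ := by rw [← hsD]; ring
    have hrr : 2 * γ * ε = s * r * ‖w - z‖ := by rw [← hr2, ← hsr, ← mul_pow, hsD]
    have hnn : 0 ≤ s * (2 * γ * ε) := by positivity
    linarith

/-- Variational inequality for inexact proximal points. -/
theorem IsInexactProx.two_mul_sub_le (hγ : 0 < γ) (hε : 0 ≤ ε)
    (hconv : ConvexOn ℝ Set.univ h) (hz : IsInexactProx γ h ε p z) (w : E N) :
    2 * γ * (h z - h w) ≤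
      2 * ⟪z - p, w - z⟫ + 2 * γ * ε + 2 * √(2 * γ * ε) * ‖w - z‖ := by
  have hcont : Continuous fun η : ℝ =>
      2 * ⟪z - p, w - z⟫ + 2 * γ * η + 2 * √(2 * γ * η) * ‖w - z‖ := by fun_prop
  refine ge_of_tendsto ((hcont.tendsto ε).mono_left nhdsWithin_le_nhds : Tendsto _ (𝓝[>] ε) _) ?_
  filter_upwards [self_mem_nhdsWithin] with η hη
  have hη' : ε < η := hη
  exact IsInexactProx.two_mul_sub_le_of_pos hγ (hε.trans_lt hη') hconv
    (fun a => (hz a).trans (by linarith)) w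

/-- One inexact proximal gradient step from `y`, compared with an arbitrary point `w`. -/
theorem IsInexactProx.proximal_gradient_le {g : E N → ℝ} {g' : E N → E N} {L : ℝ} {y : E N}
    (hL : 0 < L) (hg : ∀ a, HasGradientAt g (g' a) a)
    (hlip : ∀ a b, ‖g' a - g' b‖ ≤ L * ‖a - b‖) (hgconv : ConvexOn ℝ Set.univ g)
    (hconv : ConvexOn ℝ Set.univ h) (hγ : 0 < γ) (hγL : γ ≤ 1 / L) (hε : 0 ≤ ε)
    (hz : IsInexactProx γ h ε (y - γ • g' y) z) (w : E N) :
    2 * γ * ((g z + h z) - (g w + h w)) ≤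
      ‖w - y‖ ^ 2 - ‖w - z‖ ^ 2 + 2 * γ * ε + 2 * √(2 * γ * ε) * ‖w - z‖ := by
  have hprox := hz.two_mul_sub_le hγ hε hconv w
  have hdesc := le_add_inner_gradient_add_sq hg hlip y z
  have htan := hgconv.add_inner_gradient_le (hg y) w
  have hγL' : γ * L ≤ 1 := (le_div_iff₀ hL).1 hγL
  have hsplit : z - (y - γ • g' y) = (z - y) + γ • g' y := by module
  have hgrad : ⟪g' y, w - z⟫ = ⟪g' y, w - y⟫ - ⟪g' y, z - y⟫ := by
    rw [← inner_sub_right, sub_sub_sub_cancel_right]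
  have hwy : ‖w - y‖ ^ 2 = ‖z - y‖ ^ 2 + 2 * ⟪z - y, w - z⟫ + ‖w - z‖ ^ 2 := by
    rw [← norm_add_sq_real, add_comm, sub_add_sub_cancel]
  rw [hsplit, inner_add_left, real_inner_smul_left, hgrad] at hprox
  nlinarith [mul_le_mul_of_nonneg_right hγL' (sq_nonneg ‖z - y‖),
    mul_le_mul_of_nonneg_left hdesc hγ.le, mul_le_mul_of_nonneg_left htan hγ.le]

end InexactProx

/-- The momentum step: comparing with a convex combination of the previous iterate and the
target point `q`. -/
theorem accelerated_step_le {N : ℕ} {f : E N → ℝ} (hf : ConvexOn ℝ Set.univ f)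
    {γ ε t : ℝ} (hγ : 0 < γ) (ht : 1 ≤ t) {x y z u q : E N} (hy : t • y = (t - 1) • x + u)
    (hstep : ∀ w, 2 * γ * (f z - f w) ≤
      ‖w - y‖ ^ 2 - ‖w - z‖ ^ 2 + 2 * γ * ε + 2 * √(2 * γ * ε) * ‖w - z‖) :
    2 * γ * t ^ 2 * (f z - f q) + ‖t • z - (t - 1) • x - q‖ ^ 2 ≤
      2 * γ * (t ^ 2 - t) * (f x - f q) + ‖u - q‖ ^ 2 + 2 * γ * (t ^ 2 * ε) +
        2 * (t * √(2 * γ * ε)) * ‖t • z - (t - 1) • x - q‖ := by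
  have ht0 : 0 < t := one_pos.trans_le ht
  set w := (1 - 1 / t) • x + (1 / t) • q with hw
  have htw : t • w = (t - 1) • x + q := by
    rw [hw, smul_add, smul_smul, smul_smul, mul_sub, mul_one_div_cancel ht0.ne', mul_one, one_smul]
  have hcv : f w ≤ (1 - 1 / t) * f x + (1 / t) * f q :=
    hf.2 (Set.mem_univ x) (Set.mem_univ q)
      (sub_nonneg.2 ((div_le_one ht0).2 ht)) (by positivity) (by ring)
  have hcv' : t * f w ≤ (t - 1) * f x + f q := by
    have hmul := mul_le_mul_of_nonneg_left hcv ht0.le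
    field_simp at hmul
    linarith
  have hnz : ‖t • z - (t - 1) • x - q‖ = t * ‖w - z‖ := by
    rw [sub_sub, ← htw, ← smul_sub, norm_smul, Real.norm_of_nonneg ht0.le, norm_sub_rev]
  have hny : ‖u - q‖ = t * ‖w - y‖ := by
    have hu : u - q = t • (y - w) := by rw [smul_sub, hy, htw]; abel
    rw [hu, norm_smul, Real.norm_of_nonneg ht0.le, norm_sub_rev]
  rw [hnz, hny]
  have h1 := mul_le_mul_of_nonneg_left (hstep w) (sq_nonneg t)
  have h2 := mul_le_mul_of_nonneg_left hcv' (mul_pos (mul_pos two_pos hγ) ht0).le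
  linarith

/-- One step of the recursion absorbing an error that is linear in the current distance. -/
theorem le_sq_of_le_add_mul {W P B β e a V : ℝ} (hP : 0 ≤ P) (hB : 0 ≤ B) (hβ : 0 ≤ β)
    (he : 0 ≤ e) (hV : V ≤ (P + √B) ^ 2) (haW : a ^ 2 ≤ W) (hW : W ≤ V + β + 2 * e * a) :
    W ≤ (P + 2 * e + √(B + β)) ^ 2 := by
  have hW0 : 0 ≤ W := (sq_nonneg a).trans haW
  have has : a ≤ √W := Real.le_sqrt_of_sq_le haW
  have hs2 : √W ^ 2 = W := Real.sq_sqrt hW0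
  have hmono : √B ≤ √(B + β) := Real.sqrt_le_sqrt (by linarith)
  have hB2 : √B ^ 2 = B := Real.sq_sqrt hB
  have hBβ2 : √(B + β) ^ 2 = B + β := Real.sq_sqrt (by linarith)
  have hq : 0 ≤ √(B + β) := Real.sqrt_nonneg _
  rw [← hs2]
  refine pow_le_pow_left₀ (Real.sqrt_nonneg _) ?_ 2
  set s := √W
  set q := √(B + β)
  have hbound : s * (s - 2 * e) ≤ (P + q) ^ 2 := by
    nlinarith [mul_le_mul_of_nonneg_left has he, mul_le_mul_of_nonneg_left hmono hP]
  by_contra! hlt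
  nlinarith

/-- The Nesterov momentum sequence grows at least linearly. -/
theorem momentum_lower_bound {t : ℕ → ℝ} (ht1 : t 1 = 1)
    (htrec : ∀ k, 1 ≤ k → t (k + 1) = (√(4 * t k ^ 2 + 1) + 1) / 2) {k : ℕ} (hk : 1 ≤ k) :
    ((k : ℝ) + 1) / 2 ≤ t k := by
  induction k, hk using Nat.le_induction with
  | base => norm_num [ht1]
  | succ k hk ih =>
    have hroot : 2 * t k ≤ √(4 * t k ^ 2 + 1) := Real.le_sqrt_of_sq_le (by linarith)
    rw [htrec k hk]
    push_cast
    linarith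

theorem momentum_sq_sub_self {t : ℕ → ℝ} (ht0 : t 0 = 0) (ht1 : t 1 = 1)
    (htrec : ∀ k, 1 ≤ k → t (k + 1) = (√(4 * t k ^ 2 + 1) + 1) / 2) (k : ℕ) :
    t (k + 1) ^ 2 - t (k + 1) = t k ^ 2 := by
  rcases Nat.eq_zero_or_pos k with rfl | hk
  · simp [ht0, ht1]
  · have hroot : √(4 * t k ^ 2 + 1) ^ 2 = 4 * t k ^ 2 + 1 := Real.sq_sqrt (by positivity)
    rw [htrec k hk]
    linarith

/-- Theorem 5 — O(1/T²) rate of AIPG for convex problems. -/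
theorem aipg_convex_rate {N : ℕ} (g h : E N → ℝ) (g' : E N → E N) (L γ : ℝ)
    (hL : 0 < L)
    (hg : ∀ x, HasGradientAt g (g' x) x)
    (hlip : ∀ x y, ‖g' x - g' y‖ ≤ L * ‖x - y‖)
    (hgconv : ConvexOn ℝ Set.univ g)
    (hconv : ConvexOn ℝ Set.univ h)
    (hγ0 : 0 < γ) (hγL : γ ≤ 1 / L)
    (xstar : E N) (hmin : ∀ w, g xstar + h xstar ≤ g w + h w)
    (t : ℕ → ℝ) (ht0 : t 0 = 0) (ht1 : t 1 = 1)
    (htrec : ∀ k, 1 ≤ k → t (k + 1) = (Real.sqrt (4 * t k ^ 2 + 1) + 1) / 2)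
    (m : ℕ) (hm : 1 ≤ m)
    (x y z v : ℕ → E N) (ε : ℕ → ℝ)
    (hx1 : x 1 = x 0) (hz1 : z 1 = x 0)
    (hε : ∀ k ∈ Finset.Icc 1 m, 0 ≤ ε k)
    (hy : ∀ k ∈ Finset.Icc 1 m,
      y k = x k + (t (k - 1) / t k) • (z k - x k) +
        ((t (k - 1) - 1) / t k) • (x k - x (k - 1)))
    (hz : ∀ k ∈ Finset.Icc 1 m,
      IsInexactProx γ h (ε k) (y k - γ • g' (y k)) (z (k + 1)))
    (hv : ∀ k ∈ Finset.Icc 1 m,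
      IsInexactProx γ h (ε k) (x k - γ • g' (x k)) (v (k + 1)))
    (hx : ∀ k ∈ Finset.Icc 1 m,
      (g (z (k + 1)) + h (z (k + 1)) ≤ g (v (k + 1)) + h (v (k + 1)) →
        x (k + 1) = z (k + 1)) ∧
      (g (v (k + 1)) + h (v (k + 1)) < g (z (k + 1)) + h (z (k + 1)) →
        x (k + 1) = v (k + 1))) :
    g (x (m + 1)) + h (x (m + 1)) - (g xstar + h xstar) ≤
      2 / (γ * ((m : ℝ) + 1) ^ 2) *
        (‖x 0 - xstar‖ +
          2 * ∑ k ∈ Finset.Icc 1 m, t k * Real.sqrt (2 * γ * ε k) +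
          Real.sqrt (2 * γ * ∑ k ∈ Finset.Icc 1 m, t k ^ 2 * ε k)) ^ 2 := by
  have htlow : ∀ k : ℕ, 1 ≤ k → ((k : ℝ) + 1) / 2 ≤ t k := fun k hk =>
    momentum_lower_bound ht1 htrec hk
  have htsq := momentum_sq_sub_self ht0 ht1 htrec
  have htone : ∀ k : ℕ, 1 ≤ k → 1 ≤ t k := fun k hk => by
    have hk' : (1 : ℝ) ≤ k := by exact_mod_cast hk
    linarith [htlow k hk]
  have hA : ∀ n, 0 ≤ ∑ k ∈ Finset.Icc 1 n, t k * √(2 * γ * ε k) := fun n =>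
    Finset.sum_nonneg fun k hk =>
      mul_nonneg (zero_le_one.trans (htone k (Finset.mem_Icc.1 hk).1)) (Real.sqrt_nonneg _)
  have hB : ∀ n ≤ m, 0 ≤ 2 * γ * ∑ k ∈ Finset.Icc 1 n, t k ^ 2 * ε k := fun n hn =>
    mul_nonneg (by positivity) (Finset.sum_nonneg fun k hk =>
      mul_nonneg (sq_nonneg _) (hε k (Finset.Icc_subset_Icc_right hn hk)))
  have henergy : ∀ n ≤ m,
      2 * γ * t n ^ 2 * (g (x (n + 1)) + h (x (n + 1)) - (g xstar + h xstar)) +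
          ‖t n • z (n + 1) - (t n - 1) • x n - xstar‖ ^ 2 ≤
        (‖x 0 - xstar‖ + 2 * ∑ k ∈ Finset.Icc 1 n, t k * √(2 * γ * ε k) +
          √(2 * γ * ∑ k ∈ Finset.Icc 1 n, t k ^ 2 * ε k)) ^ 2 := by
    intro n
    induction n with
    | zero => simp [ht0]
    | succ n ih =>
      intro hn
      have hmem : n + 1 ∈ Finset.Icc 1 m := Finset.mem_Icc.2 ⟨by omega, hn⟩
      have ht : 1 ≤ t (n + 1) := htone _ (by omega)
      have hεn := hε _ hmem
      have hty : t (n + 1) • y (n + 1) =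
          (t (n + 1) - 1) • x (n + 1) + (t n • z (n + 1) - (t n - 1) • x n) := by
        have htne : t (n + 1) ≠ 0 := by linarith
        rw [hy _ hmem, Nat.add_sub_cancel, smul_add, smul_add, smul_smul, smul_smul,
          mul_div_cancel₀ _ htne, mul_div_cancel₀ _ htne]
        module
      have hstep := accelerated_step_le (hgconv.add hconv) hγ0 ht (q := xstar) hty
        ((hz _ hmem).proximal_gradient_le hL hg hlip hgconv hconv hγ0 hγL hεn)
      simp only [Pi.add_apply, htsq] at hstep
      have hmonotone : g (x (n + 1 + 1)) + h (x (n + 1 + 1)) ≤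
          g (z (n + 1 + 1)) + h (z (n + 1 + 1)) := by
        rcases le_or_gt (g (z (n + 1 + 1)) + h (z (n + 1 + 1)))
          (g (v (n + 1 + 1)) + h (v (n + 1 + 1))) with hle | hlt
        · rw [(hx _ hmem).1 hle]
        · rw [(hx _ hmem).2 hlt]
          exact hlt.le
      have hscaled := mul_le_mul_of_nonneg_left (sub_le_sub_right hmonotone (g xstar + h xstar))
        (by positivity : 0 ≤ 2 * γ * t (n + 1) ^ 2)
      have hgap : 0 ≤ 2 * γ * t (n + 1) ^ 2 *
          (g (x (n + 1 + 1)) + h (x (n + 1 + 1)) - (g xstar + h xstar)) :=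
        mul_nonneg (by positivity) (sub_nonneg.2 (hmin _))
      rw [Finset.sum_Icc_succ_top (by omega), Finset.sum_Icc_succ_top (by omega), mul_add 2,
        ← add_assoc, mul_add (2 * γ)]
      exact le_sq_of_le_add_mul (add_nonneg (norm_nonneg _) (mul_nonneg zero_le_two (hA n)))
        (hB n (by omega)) (by positivity) (by positivity) (ih (by omega))
        (le_add_of_nonneg_left hgap) (by linarith)
  have hfinal := (le_add_of_nonneg_right (sq_nonneg _)).trans (henergy m le_rfl)
  have hsq : (((m : ℝ) + 1) / 2) ^ 2 ≤ t m ^ 2 := pow_le_pow_left₀ (by positivity) (htlow m hm) 2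
  have hgap := sub_nonneg.2 (hmin (x (m + 1)))
  rw [div_mul_eq_mul_div, le_div_iff₀ (by positivity)]
  linarith [mul_le_mul_of_nonneg_right hsq (mul_nonneg hγ0.le hgap)]
end
end

section
/- (Uniformized ε-KL property, Lemma 1.) Let g : ℝ^N → ℝ be differentiable, h : ℝ^N → ℝ, ε ≥ 0, and f = g + h. Let Ω ⊆ ℝ^N be a nonempty compact set on which f is constant with value f₀, and suppose f satisfies the ε-KL property at every point ū ∈ Ω: there exist η ∈ (0, +∞], a neighborhood U of ū, and a function φ : [0, η) → [0, ∞) that is continuous at 0 with φ(0) = 0, concave and continuously differentiable on (0, η) with φ'(x) > 0 for all x ∈ (0, η), such that for all u ∈ U with f₀ < f(u) < f₀ + η one has φ'(f(u) − f₀)·dist(0, ∇g(u) + ∂_ε h(u)) ≥ 1. Then there exist ϵ > 0, η > 0, and one function φ of this class such that for every u ∈ ℝ^N with dist(u, Ω) < ϵ and f₀ < f(u) < f₀ + η, one has φ'(f(u) − f₀)·dist(0, ∇g(u) + ∂_ε h(u)) ≥ 1. -/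
open scoped RealInnerProductSpace
open Filter Topology

noncomputable section

/-- `φ`, with derivative `φ'`, is a desingularizing function on `[0, η)`. -/
structure IsDesingularizing (η : ℝ) (φ φ' : ℝ → ℝ) : Prop where
  continuousWithinAt : ContinuousWithinAt φ (Set.Ico 0 η) 0
  map_zero : φ 0 = 0
  nonneg : ∀ s ∈ Set.Ico (0 : ℝ) η, 0 ≤ φ s
  concaveOn : ConcaveOn ℝ (Set.Ioo 0 η) φ
  hasDerivAt : ∀ s ∈ Set.Ioo (0 : ℝ) η, HasDerivAt φ (φ' s) s
  continuousOn : ContinuousOn φ' (Set.Ioo 0 η)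
  pos : ∀ s ∈ Set.Ioo (0 : ℝ) η, 0 < φ' s

namespace IsDesingularizing

theorem id (η : ℝ) : IsDesingularizing η (fun s => s) (fun _ => 1) where
  continuousWithinAt := continuousWithinAt_id
  map_zero := rfl
  nonneg _ hs := hs.1
  concaveOn := concaveOn_id (convex_Ioo 0 η)
  hasDerivAt s _ := hasDerivAt_id s
  continuousOn := continuousOn_const
  pos _ _ := one_pos

theorem mono {η ζ : ℝ} {φ φ' : ℝ → ℝ} (H : IsDesingularizing η φ φ') (hζ : ζ ≤ η) :
    IsDesingularizing ζ φ φ' where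
  continuousWithinAt := H.continuousWithinAt.mono (Set.Ico_subset_Ico_right hζ)
  map_zero := H.map_zero
  nonneg s hs := H.nonneg s (Set.Ico_subset_Ico_right hζ hs)
  concaveOn := H.concaveOn.subset (Set.Ioo_subset_Ioo_right hζ) (convex_Ioo 0 ζ)
  hasDerivAt s hs := H.hasDerivAt s (Set.Ioo_subset_Ioo_right hζ hs)
  continuousOn := H.continuousOn.mono (Set.Ioo_subset_Ioo_right hζ)
  pos s hs := H.pos s (Set.Ioo_subset_Ioo_right hζ hs)

theorem add {η : ℝ} {φ φ' ψ ψ' : ℝ → ℝ} (H : IsDesingularizing η φ φ')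
    (K : IsDesingularizing η ψ ψ') : IsDesingularizing η (φ + ψ) (φ' + ψ') where
  continuousWithinAt := H.continuousWithinAt.add K.continuousWithinAt
  map_zero := by simp [H.map_zero, K.map_zero]
  nonneg s hs := add_nonneg (H.nonneg s hs) (K.nonneg s hs)
  concaveOn := H.concaveOn.add K.concaveOn
  hasDerivAt s hs := (H.hasDerivAt s hs).add (K.hasDerivAt s hs)
  continuousOn := H.continuousOn.add K.continuousOn
  pos s hs := add_pos (H.pos s hs) (K.pos s hs)

end IsDesingularizing

/-- The inequality `1 ≤ φ' (f u) * r` for all `r ∈ D u`, required near `S` wherever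
`0 < f u < η`, with one desingularizing function for the whole of `S`. -/
def HasUniformKL {X : Type*} [TopologicalSpace X] (f : X → ℝ) (D : X → Set ℝ)
    (S : Set X) : Prop :=
  ∃ η : ℝ, 0 < η ∧ ∃ φ φ' : ℝ → ℝ, IsDesingularizing η φ φ' ∧
    ∀ᶠ u in 𝓝ˢ S, f u ∈ Set.Ioo 0 η → ∀ r ∈ D u, 1 ≤ φ' (f u) * r

namespace HasUniformKL

variable {X : Type*} [TopologicalSpace X] {f : X → ℝ} {D : X → Set ℝ} {S T : Set X}

theorem empty (f : X → ℝ) (D : X → Set ℝ) : HasUniformKL f D ∅ :=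
  ⟨1, one_pos, _, _, .id 1, by simp⟩

theorem mono (h : HasUniformKL f D T) (hST : S ⊆ T) : HasUniformKL f D S := by
  obtain ⟨η, hη, φ, φ', H, hf⟩ := h
  exact ⟨η, hη, φ, φ', H, hf.filter_mono (nhdsSet_mono hST)⟩

theorem union (hD : ∀ u, ∀ r ∈ D u, 0 ≤ r) (hS : HasUniformKL f D S)
    (hT : HasUniformKL f D T) : HasUniformKL f D (S ∪ T) := by
  obtain ⟨η, hη, φ, φ', H, hf⟩ := hS
  obtain ⟨ζ, hζ, ψ, ψ', K, hg⟩ := hT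
  have H' := H.mono (min_le_left η ζ)
  have K' := K.mono (min_le_right η ζ)
  refine ⟨min η ζ, lt_min hη hζ, _, _, H'.add K', ?_⟩
  rw [nhdsSet_union, Filter.eventually_sup]
  constructor
  · filter_upwards [hf] with u hu hmem r hr
    have h₁ := hu (Set.Ioo_subset_Ioo_right (min_le_left η ζ) hmem) r hr
    have h₂ := mul_nonneg (K'.pos _ hmem).le (hD u r hr)
    rw [Pi.add_apply, add_mul]
    linarith
  · filter_upwards [hg] with u hu hmem r hr
    have h₁ := hu (Set.Ioo_subset_Ioo_right (min_le_right η ζ) hmem) r hr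
    have h₂ := mul_nonneg (H'.pos _ hmem).le (hD u r hr)
    rw [Pi.add_apply, add_mul]
    linarith

theorem of_isCompact (hD : ∀ u, ∀ r ∈ D u, 0 ≤ r) (hS : IsCompact S)
    (h : ∀ x ∈ S, HasUniformKL f D {x}) : HasUniformKL f D S := by
  refine hS.induction_on (empty f D) (fun _ _ hst ht => ht.mono hst)
    (fun _ _ hs ht => hs.union hD ht) fun x hx => ?_
  obtain ⟨η, hη, φ, φ', H, hf⟩ := h x hx
  rw [nhdsSet_singleton] at hf
  obtain ⟨t, ht, ht_open, hxt⟩ := eventually_nhds_iff.1 hf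
  exact ⟨t, mem_nhdsWithin_of_mem_nhds (ht_open.mem_nhds hxt), η, hη, φ, φ', H,
    Filter.eventually_of_mem (ht_open.mem_nhdsSet_self) ht⟩

end HasUniformKL

/-- uniformized ε-KL property (Lemma 1). -/
theorem uniformized_eps_KL {N : ℕ} (g h : E N → ℝ) (g' : E N → E N)
    (hg : ∀ x, HasGradientAt g (g' x) x)
    (ε : ℝ) (hε : 0 ≤ ε)
    (Ω : Set (E N)) (hΩne : Ω.Nonempty) (hΩc : IsCompact Ω)
    (f0 : ℝ) (hconst : ∀ u ∈ Ω, g u + h u = f0)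
    (hKL : ∀ ubar ∈ Ω, ∃ η : ℝ, 0 < η ∧ ∃ U ∈ 𝓝 ubar, ∃ φ φ' : ℝ → ℝ,
      ContinuousWithinAt φ (Set.Ico 0 η) 0 ∧ φ 0 = 0 ∧
      (∀ s ∈ Set.Ico (0:ℝ) η, 0 ≤ φ s) ∧
      ConcaveOn ℝ (Set.Ioo 0 η) φ ∧
      (∀ s ∈ Set.Ioo (0:ℝ) η, HasDerivAt φ (φ' s) s) ∧
      ContinuousOn φ' (Set.Ioo 0 η) ∧
      (∀ s ∈ Set.Ioo (0:ℝ) η, 0 < φ' s) ∧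
      (∀ u ∈ U, f0 < g u + h u → g u + h u < f0 + η →
        ∀ d ∈ epsSubdiff h ε u, 1 ≤ φ' (g u + h u - f0) * ‖g' u + d‖)) :
    ∃ ϵ : ℝ, 0 < ϵ ∧ ∃ η : ℝ, 0 < η ∧ ∃ φ φ' : ℝ → ℝ,
      ContinuousWithinAt φ (Set.Ico 0 η) 0 ∧ φ 0 = 0 ∧
      (∀ s ∈ Set.Ico (0:ℝ) η, 0 ≤ φ s) ∧
      ConcaveOn ℝ (Set.Ioo 0 η) φ ∧
      (∀ s ∈ Set.Ioo (0:ℝ) η, HasDerivAt φ (φ' s) s) ∧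
      ContinuousOn φ' (Set.Ioo 0 η) ∧
      (∀ s ∈ Set.Ioo (0:ℝ) η, 0 < φ' s) ∧
      (∀ u : E N, Metric.infDist u Ω < ϵ → f0 < g u + h u → g u + h u < f0 + η →
        ∀ d ∈ epsSubdiff h ε u, 1 ≤ φ' (g u + h u - f0) * ‖g' u + d‖) := by
  let D : E N → Set ℝ := fun u => {r | ∃ d ∈ epsSubdiff h ε u, r = ‖g' u + d‖}
  have hD : ∀ u, ∀ r ∈ D u, 0 ≤ r := by
    rintro u r ⟨d, -, rfl⟩
    exact norm_nonneg _
  have huniform : HasUniformKL (fun u => g u + h u - f0) D Ω := by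
    refine .of_isCompact hD hΩc fun x hx => ?_
    obtain ⟨η, hη, U, hU, φ, φ', h₁, h₂, h₃, h₄, h₅, h₆, h₇, hineq⟩ := hKL x hx
    refine ⟨η, hη, φ, φ', ⟨h₁, h₂, h₃, h₄, h₅, h₆, h₇⟩, ?_⟩
    rw [nhdsSet_singleton]
    filter_upwards [hU] with u hu hmem
    rintro r ⟨d, hd, rfl⟩
    exact hineq u hu (by linarith [hmem.1]) (by linarith [hmem.2]) d hd
  obtain ⟨η, hη, φ, φ', H, hineq⟩ := huniform
  obtain ⟨ϵ, hϵ, hsub⟩ := (Metric.hasBasis_nhdsSet_thickening hΩc).mem_iff.1 hineq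
  refine ⟨ϵ, hϵ, η, hη, φ, φ', H.continuousWithinAt, H.map_zero, H.nonneg, H.concaveOn,
    H.hasDerivAt, H.continuousOn, H.pos, fun u hu hlt hlt' d hd => ?_⟩
  exact hsub ((Metric.mem_thickening_iff_infDist_lt hΩne).2 hu)
    ⟨by linarith, by linarith⟩ _ ⟨d, hd, rfl⟩
end
end

section
/- (One-step descent of inexact proximal gradient, general h.) Let h : ℝ^N → ℝ be arbitrary (possibly non-convex), let g : ℝ^N → ℝ be differentiable with L-Lipschitz continuous gradient, let f = g + h, let γ > 0, let ε ≥ 0, and let x, x₊ ∈ ℝ^N with x₊ ∈ Prox^ε_{γh}(x − γ∇g(x)). Then f(x₊) ≤ f(x) − (1/(2γ) − L/2)·‖x₊ − x‖² + ε. -/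
open scoped RealInnerProductSpace
open Filter Topology

noncomputable section

/-- Descent lemma: a function with `L`-Lipschitz gradient lies below its quadratic upper model. -/
theorem le_add_inner_add_sq_of_lipschitz_gradient {F : Type*} [NormedAddCommGroup F]
    [InnerProductSpace ℝ F] [CompleteSpace F] {g : F → ℝ} {g' : F → F} {L : ℝ}
    (hg : ∀ x, HasGradientAt g (g' x) x) (hlip : ∀ x y, ‖g' x - g' y‖ ≤ L * ‖x - y‖) (x y : F) :
    g y ≤ g x + ⟪g' x, y - x⟫ + L / 2 * ‖y - x‖ ^ 2 := by
  have hline (t : ℝ) : HasDerivAt (fun s : ℝ => x + s • (y - x)) (y - x) t := by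
    simpa using ((hasDerivAt_id t).smul_const (y - x)).const_add x
  have hderiv (t : ℝ) : HasDerivAt (fun s : ℝ => g (x + s • (y - x)))
      ⟪g' (x + t • (y - x)), y - x⟫ t := by
    simpa [Function.comp_def] using (hg (x + t • (y - x))).hasFDerivAt.comp_hasDerivAt t (hline t)
  have hmodel (t : ℝ) : HasDerivAt
      (fun s : ℝ => g x + s * ⟪g' x, y - x⟫ + s ^ 2 * (L / 2 * ‖y - x‖ ^ 2))
      (⟪g' x, y - x⟫ + t * (L * ‖y - x‖ ^ 2)) t := by
    refine ((((hasDerivAt_id t).mul_const ⟪g' x, y - x⟫).const_add (g x)).add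
      ((hasDerivAt_pow 2 t).mul_const (L / 2 * ‖y - x‖ ^ 2))).congr_deriv ?_
    norm_num
    ring
  have hbound (t : ℝ) (ht : t ∈ Set.Ico (0 : ℝ) 1) :
      ⟪g' (x + t • (y - x)), y - x⟫ ≤ ⟪g' x, y - x⟫ + t * (L * ‖y - x‖ ^ 2) := by
    rw [← sub_le_iff_le_add', ← inner_sub_left]
    calc ⟪g' (x + t • (y - x)) - g' x, y - x⟫
        ≤ ‖g' (x + t • (y - x)) - g' x‖ * ‖y - x‖ := real_inner_le_norm _ _
      _ ≤ L * ‖x + t • (y - x) - x‖ * ‖y - x‖ := by gcongr; exact hlip _ _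
      _ = t * (L * ‖y - x‖ ^ 2) := by
        rw [add_sub_cancel_left, norm_smul, Real.norm_of_nonneg ht.1]
        ring
  have key := image_le_of_deriv_right_le_deriv_boundary
    (fun t _ => (hderiv t).continuousAt.continuousWithinAt)
    (fun t _ => (hderiv t).hasDerivWithinAt) (by simp)
    (fun t _ => (hmodel t).continuousAt.continuousWithinAt)
    (fun t _ => (hmodel t).hasDerivWithinAt) hbound (Set.right_mem_Icc.mpr zero_le_one)
  simpa using key

/-- one-step descent of the inexact proximal gradient step, general `h`. -/
theorem ipg_one_step_descent_general_h {N : ℕ} (g h : E N → ℝ) (g' : E N → E N)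
    (L γ ε : ℝ) (hL : 0 < L)
    (hg : ∀ x, HasGradientAt g (g' x) x)
    (hlip : ∀ x y, ‖g' x - g' y‖ ≤ L * ‖x - y‖)
    (hγ0 : 0 < γ) (hε : 0 ≤ ε)
    (x xp : E N)
    (hstep : IsInexactProx γ h ε (x - γ • g' x) xp) :
    g xp + h xp ≤ g x + h x - (1 / (2 * γ) - L / 2) * ‖xp - x‖ ^ 2 + ε := by
  have hdesc := le_add_inner_add_sq_of_lipschitz_gradient hg hlip x xp
  have hprox := hstep x
  have hxp : ‖xp - (x - γ • g' x)‖ ^ 2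
      = ‖xp - x‖ ^ 2 + 2 * γ * ⟪g' x, xp - x⟫ + ‖γ • g' x‖ ^ 2 := by
    rw [sub_sub_eq_add_sub, add_sub_right_comm, norm_add_sq_real, real_inner_smul_right,
      real_inner_comm]
    ring
  rw [hxp, sub_sub_cancel] at hprox
  have hcancel : 1 / (2 * γ) * (2 * γ * ⟪g' x, xp - x⟫) = ⟪g' x, xp - x⟫ := by
    field_simp
  rw [mul_add, mul_add, hcancel] at hprox
  linarith
end
end
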